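/- arXiv:1910.01475 — 6 statements merged into one kernel-verified Lean document; each statement's English description precedes it below -/
import Mathlib

section
/- Let φ: 𝔻 → 𝔻 be holomorphic with φ(0) = 0 and φ not an automorphism of 𝔻, and let w be holomorphic on 𝔻 with |w(0)| < 1. If f is holomorphic on 𝔻, λ ∈ ℂ with |λ| ≥ 1, and w(z)·f(φ(z)) = λ·f(z) for all z ∈ 𝔻, then f is identically zero. (In particular, a weighted composition operator T_{w,φ} with these data has no eigenvalues of modulus at least 1.) -/
open Complex Metric Filter Topology

/-- Let `φ : 𝔻 → 𝔻` be holomorphic with `φ(0) = 0` and `φ` not an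
automorphism of `𝔻`, and let `w` be holomorphic on `𝔻` with `|w(0)| < 1`.  If `f` is
holomorphic on `𝔻`, `λ ∈ ℂ` with `|λ| ≥ 1`, and `w(z)·f(φ(z)) = λ·f(z)` on `𝔻`,
then `f ≡ 0` (so `T_{w,φ}` has no eigenvalue of modulus at least one). -/
theorem eigenfunction_zero_of_norm_weight_lt_one
    (φ w f : ℂ → ℂ)
    (hφ : DifferentiableOn ℂ φ (ball (0:ℂ) 1))
    (hφmaps : Set.MapsTo φ (ball (0:ℂ) 1) (ball (0:ℂ) 1))
    (hφ0 : φ 0 = 0)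
    (hnotaut : ¬ ∃ ψ : ℂ → ℂ, DifferentiableOn ℂ ψ (ball (0:ℂ) 1) ∧
        Set.MapsTo ψ (ball (0:ℂ) 1) (ball (0:ℂ) 1) ∧
        (∀ z ∈ ball (0:ℂ) 1, ψ (φ z) = z) ∧ (∀ z ∈ ball (0:ℂ) 1, φ (ψ z) = z))
    (hw : DifferentiableOn ℂ w (ball (0:ℂ) 1))
    (hw0 : ‖w 0‖ < 1)
    (hf : DifferentiableOn ℂ f (ball (0:ℂ) 1))
    (lam : ℂ) (hlam : 1 ≤ ‖lam‖)
    (heig : ∀ z ∈ ball (0:ℂ) 1, w z * f (φ z) = lam * f z) :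
    ∀ z ∈ ball (0:ℂ) 1, f z = 0 := by
  have hnh : ball (0:ℂ) 1 ∈ 𝓝 (0:ℂ) := ball_mem_nhds _ one_pos
  have hwc : ContinuousAt w 0 := hw.continuousOn.continuousAt hnh
  have hev : ∀ᶠ z in 𝓝 (0:ℂ), ‖w z‖ < 1 ∧ z ∈ ball (0:ℂ) 1 :=
    (hwc.norm.eventually (gt_mem_nhds hw0)).and hnh
  obtain ⟨r, hr, hsub⟩ := Metric.nhds_basis_closedBall.eventually_iff.1 hev
  have hfc : ContinuousOn (fun z => ‖f z‖) (closedBall (0:ℂ) r) :=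
    (hf.continuousOn.mono (fun z hz => (hsub hz).2)).norm
  obtain ⟨z₀, hz₀, hmax⟩ := (isCompact_closedBall (0:ℂ) r).exists_isMaxOn
    ⟨0, mem_closedBall_self hr.le⟩ hfc
  obtain ⟨h1, h2⟩ := hsub hz₀
  have hle : ‖φ z₀‖ ≤ ‖z₀‖ :=
    Complex.norm_le_norm_of_mapsTo_ball hφ
      (fun z hz => ball_subset_closedBall (hφmaps hz)) hφ0 (by simpa using h2)
  have hφz : φ z₀ ∈ closedBall (0:ℂ) r := by
    rw [mem_closedBall_zero_iff] at *
    exact hle.trans hz₀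
  have hm : ‖f (φ z₀)‖ ≤ ‖f z₀‖ := hmax hφz
  have he : ‖w z₀‖ * ‖f (φ z₀)‖ = ‖lam‖ * ‖f z₀‖ := by
    rw [← norm_mul, ← norm_mul, heig z₀ h2]
  have hzero : ‖f z₀‖ = 0 := by
    by_contra hne
    have hpos : 0 < ‖f z₀‖ := lt_of_le_of_ne (norm_nonneg _) (Ne.symm hne)
    have a1 := mul_le_mul_of_nonneg_left hm (norm_nonneg (w z₀))
    have a2 := mul_lt_mul_of_pos_right h1 hpos
    have a3 := mul_le_mul_of_nonneg_right hlam hpos.le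
    linarith
  have hloc : f =ᶠ[𝓝 0] 0 := by
    filter_upwards [closedBall_mem_nhds (0:ℂ) hr] with z hz
    have h3 : ‖f z‖ ≤ ‖f z₀‖ := hmax hz
    rw [hzero] at h3
    exact norm_le_zero_iff.1 h3
  exact (hf.analyticOnNhd isOpen_ball).eqOn_zero_of_preconnected_of_eventuallyEq_zero
    (convex_ball (0:ℂ) 1).isPreconnected (mem_ball_self one_pos) hloc
end

section
/- Let φ: 𝔻 → 𝔻 be holomorphic with φ(0) = 0 and φ not an automorphism of 𝔻, and let w be holomorphic on 𝔻 with w(0) = 1. If f is holomorphic on 𝔻, λ ∈ ℂ with |λ| = 1 and λ ≠ 1, and w(z)·f(φ(z)) = λ·f(z) for all z ∈ 𝔻, then f is identically zero. (In particular, the only possible unimodular eigenvalue of such a weighted composition operator T_{w,φ} is 1.) -/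
open Complex Metric Filter Topology

/-- Let `φ : 𝔻 → 𝔻` be holomorphic with `φ(0) = 0` and `φ` not an
automorphism of `𝔻`, and let `w` be holomorphic on `𝔻` with `w(0) = 1`.  If `f` is
holomorphic on `𝔻`, `λ ∈ ℂ` with `|λ| = 1` and `λ ≠ 1`, and `w(z)·f(φ(z)) = λ·f(z)`
on `𝔻`, then `f ≡ 0` (so the only possible unimodular eigenvalue of `T_{w,φ}` is `1`). -/
theorem eigenfunction_zero_of_unimodular_ne_one
    (φ w f : ℂ → ℂ)
    (hφ : DifferentiableOn ℂ φ (ball (0:ℂ) 1))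
    (hφmaps : Set.MapsTo φ (ball (0:ℂ) 1) (ball (0:ℂ) 1))
    (hφ0 : φ 0 = 0)
    (hnotaut : ¬ ∃ ψ : ℂ → ℂ, DifferentiableOn ℂ ψ (ball (0:ℂ) 1) ∧
        Set.MapsTo ψ (ball (0:ℂ) 1) (ball (0:ℂ) 1) ∧
        (∀ z ∈ ball (0:ℂ) 1, ψ (φ z) = z) ∧ (∀ z ∈ ball (0:ℂ) 1, φ (ψ z) = z))
    (hw : DifferentiableOn ℂ w (ball (0:ℂ) 1))
    (hw0 : w 0 = 1)
    (hf : DifferentiableOn ℂ f (ball (0:ℂ) 1))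
    (lam : ℂ) (hlam : ‖lam‖ = 1) (hlam1 : lam ≠ 1)
    (heig : ∀ z ∈ ball (0:ℂ) 1, w z * f (φ z) = lam * f z) :
    ∀ z ∈ ball (0:ℂ) 1, f z = 0 := by
  have hb : ball (0:ℂ) 1 ∈ 𝓝 (0:ℂ) := ball_mem_nhds _ one_pos
  have h0 : (0:ℂ) ∈ ball (0:ℂ) 1 := mem_ball_self one_pos
  have hfa : AnalyticOnNhd ℂ f (ball (0:ℂ) 1) := hf.analyticOnNhd isOpen_ball
  by_cases hz : ∀ᶠ z in 𝓝 (0:ℂ), f z = 0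
  · exact fun z hzz => hfa.eqOn_zero_of_preconnected_of_eventuallyEq_zero
      (convex_ball (0:ℂ) 1).isPreconnected h0 hz hzz
  exfalso
  obtain ⟨n, g, hg, hg0, hfg⟩ := (hfa 0 h0).exists_eventuallyEq_pow_smul_nonzero_iff.mpr hz
  have hφd : DifferentiableAt ℂ φ 0 := hφ.differentiableAt hb
  have hφc : Tendsto φ (𝓝 0) (𝓝 0) := by simpa [ContinuousAt, hφ0] using hφd.continuousAt
  have hd : ContinuousAt (dslope φ 0) 0 := continuousAt_dslope_same.2 hφd
  have hwc : ContinuousAt w 0 := (hw.differentiableAt hb).continuousAt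
  have hgc : ContinuousAt g 0 := hg.continuousAt
  have hgφ : Tendsto (fun z => g (φ z)) (𝓝 0) (𝓝 (g 0)) := hgc.tendsto.comp hφc
  have hL : Tendsto (fun z => w z * dslope φ 0 z ^ n * g (φ z)) (𝓝[≠] 0)
      (𝓝 (w 0 * dslope φ 0 0 ^ n * g 0)) :=
    ((hwc.tendsto.mul (hd.tendsto.pow n)).mul hgφ).mono_left nhdsWithin_le_nhds
  have hR : Tendsto (fun z => lam * g z) (𝓝[≠] 0) (𝓝 (lam * g 0)) :=
    (hgc.tendsto.const_mul lam).mono_left nhdsWithin_le_nhds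
  have heq : (fun z => w z * dslope φ 0 z ^ n * g (φ z)) =ᶠ[𝓝[≠] 0] fun z => lam * g z := by
    filter_upwards [self_mem_nhdsWithin, mem_nhdsWithin_of_mem_nhds hb,
      mem_nhdsWithin_of_mem_nhds hfg, mem_nhdsWithin_of_mem_nhds (hφc.eventually hfg)]
      with z hz0 hzb h1 h2
    have hz0' : z ≠ 0 := hz0
    have h3 := heig z hzb
    simp only [sub_zero, smul_eq_mul] at h1 h2
    have h4 : φ z = z * dslope φ 0 z := by
      have := sub_smul_dslope φ 0 z
      simpa [hφ0] using this.symm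
    have h5 : f (φ z) = (z * dslope φ 0 z) ^ n * g (φ z) := by rw [← h4]; exact h2
    rw [h1, h5, mul_pow] at h3
    apply mul_left_cancel₀ (pow_ne_zero n hz0')
    linear_combination h3
  have hlim := tendsto_nhds_unique (hL.congr' heq) hR
  rw [hw0, one_mul] at hlim
  have hpow : dslope φ 0 0 ^ n = lam := mul_right_cancel₀ hg0 hlim
  have hn : n ≠ 0 := by
    rintro rfl
    exact hlam1 (by simpa using hpow.symm)
  have hnorm : ‖dslope φ 0 0‖ = 1 := by
    rw [← pow_eq_one_iff_of_nonneg (norm_nonneg _) hn, ← norm_pow, hpow, hlam]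
  have haff := affine_of_mapsTo_ball_of_norm_dslope_eq_div (f := φ) (c := 0) (R₁ := 1) (R₂ := 1)
    (z₀ := 0) hφ (by simpa [hφ0] using hφmaps.mono_right ball_subset_closedBall) h0 (by simpa using hnorm)
  set c := dslope φ 0 0 with hc
  have hc0 : c ≠ 0 := by
    intro h; simp [h] at hnorm
  have hφe : ∀ z ∈ ball (0:ℂ) 1, φ z = z * c := fun z hzz => by simpa [hφ0] using haff hzz
  have hψm : Set.MapsTo (fun z => z * c⁻¹) (ball (0:ℂ) 1) (ball (0:ℂ) 1) := by
    intro z hzz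
    simpa [hnorm] using hzz
  refine hnotaut ⟨fun z => z * c⁻¹, by fun_prop, hψm, fun z hzz => ?_, fun z hzz => ?_⟩
  · simp only [hφe z hzz]
    field_simp
  · rw [hφe _ (hψm hzz)]
    field_simp
end

section
/- Let φ: 𝔻 → 𝔻 be holomorphic with φ(0) = 0 and φ not an automorphism of 𝔻, and let w be holomorphic on 𝔻 with w(0) = 1. Then the partial products Wₙ(z) = w(z)·w(φ(z))⋯w(φ_{n−1}(z)) converge uniformly on compact subsets of 𝔻 to a holomorphic function 𝑤̃ on 𝔻; moreover every holomorphic function f on 𝔻 satisfying f(z) = w(z)·f(φ(z)) for all z ∈ 𝔻 equals f(0)·𝑤̃, so the space of such fixed functions is at most one-dimensional, spanned by 𝑤̃. -/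
open Complex Metric Filter Topology

lemma aux_key
    (φ w : ℂ → ℂ)
    (hφ : DifferentiableOn ℂ φ (ball (0:ℂ) 1))
    (hφmaps : Set.MapsTo φ (ball (0:ℂ) 1) (ball (0:ℂ) 1))
    (hφ0 : φ 0 = 0)
    (hnotaut : ¬ ∃ ψ : ℂ → ℂ, DifferentiableOn ℂ ψ (ball (0:ℂ) 1) ∧
        Set.MapsTo ψ (ball (0:ℂ) 1) (ball (0:ℂ) 1) ∧
        (∀ z ∈ ball (0:ℂ) 1, ψ (φ z) = z) ∧ (∀ z ∈ ball (0:ℂ) 1, φ (ψ z) = z))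
    (z : ℂ) (hz : z ∈ ball (0:ℂ) 1) : ‖dslope φ 0 z‖ < 1 := by
  have hm : Set.MapsTo φ (ball (0:ℂ) 1) (closedBall (φ 0) 1) := by
    rw [hφ0]; exact fun x hx => ball_subset_closedBall (hφmaps hx)
  have h1 := norm_dslope_le_div_of_mapsTo_ball hφ hm hz
  rw [div_one] at h1
  refine lt_of_le_of_ne h1 fun heq => hnotaut ?_
  have haff := affine_of_mapsTo_ball_of_norm_dslope_eq_div hφ hm hz (by rw [heq, div_one])
  set c := dslope φ 0 z
  have hc : c ≠ 0 := by
    intro h; rw [h] at heq; simp at heq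
  have hφc : ∀ x ∈ ball (0:ℂ) 1, φ x = x * c := by
    intro x hx
    simpa [hφ0] using haff hx
  have hmaps : Set.MapsTo (fun x => x / c) (ball (0:ℂ) 1) (ball (0:ℂ) 1) := by
    intro x hx
    simpa [heq] using hx
  refine ⟨fun x => x / c, by fun_prop, hmaps, ?_, ?_⟩
  · intro x hx
    simp only [hφc x hx]
    field_simp
  · intro x hx
    rw [hφc _ (hmaps hx)]
    field_simp

lemma aux_bound (φ : ℂ → ℂ)
    (hφ : DifferentiableOn ℂ φ (ball (0:ℂ) 1))
    (hφ0 : φ 0 = 0)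
    (hlt : ∀ z ∈ ball (0:ℂ) 1, ‖dslope φ 0 z‖ < 1) (r : ℝ) (hr0 : 0 ≤ r) (hr : r < 1) :
    ∃ δ : ℝ, 0 ≤ δ ∧ δ < 1 ∧ ∀ n : ℕ, ∀ z ∈ closedBall (0:ℂ) r, ‖φ^[n] z‖ ≤ δ ^ n * r := by
  have hsub : closedBall (0:ℂ) r ⊆ ball 0 1 := closedBall_subset_ball hr
  have hd : ContinuousOn (dslope φ 0) (closedBall (0:ℂ) r) :=
    (((Complex.differentiableOn_dslope (isOpen_ball.mem_nhds (mem_ball_self one_pos))).mpr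
      hφ).continuousOn).mono hsub
  obtain ⟨z0, hz0, hmax⟩ := (isCompact_closedBall (0:ℂ) r).exists_isMaxOn
    ⟨0, mem_closedBall_self hr0⟩ hd.norm
  refine ⟨‖dslope φ 0 z0‖, norm_nonneg _, hlt _ (hsub hz0), ?_⟩
  set δ := ‖dslope φ 0 z0‖
  have hδ1 : δ < 1 := hlt _ (hsub hz0)
  have hδ0 : 0 ≤ δ := norm_nonneg _
  intro n z hz
  induction n with
  | zero => simpa using hz
  | succ n ih =>
    rw [Function.iterate_succ_apply']
    have hle : δ ^ n * r ≤ r := mul_le_of_le_one_left hr0 (pow_le_one₀ hδ0 hδ1.le)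
    have hmem : φ^[n] z ∈ closedBall (0:ℂ) r := by
      simpa using ih.trans hle
    have h2 : ‖dslope φ 0 (φ^[n] z)‖ ≤ δ := hmax hmem
    have h3 := sub_smul_dslope φ 0 (φ^[n] z)
    simp only [hφ0, sub_zero, smul_eq_mul] at h3
    rw [← h3, norm_mul, pow_succ]
    calc _ ≤ (δ ^ n * r) * δ := mul_le_mul ih h2 (norm_nonneg _) (by positivity)
      _ = _ := by ring

/-- Let `φ : 𝔻 → 𝔻` be holomorphic with `φ(0) = 0` and `φ` not an
automorphism of `𝔻`, and let `w` be holomorphic on `𝔻` with `w(0) = 1`.  Then the partial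
products `Wₙ(z) = w(z)·w(φ(z))⋯w(φ_{n−1}(z))` converge locally uniformly on `𝔻` to a
holomorphic function `w̃`, and every holomorphic `f` on `𝔻` with `f = w·(f∘φ)` equals
`f(0)·w̃`; in particular the space of such fixed functions is at most one-dimensional,
spanned by `w̃`. -/
theorem fixedFunctions_spanned_by_infinite_product
    (φ w : ℂ → ℂ)
    (hφ : DifferentiableOn ℂ φ (ball (0:ℂ) 1))
    (hφmaps : Set.MapsTo φ (ball (0:ℂ) 1) (ball (0:ℂ) 1))
    (hφ0 : φ 0 = 0)
    (hnotaut : ¬ ∃ ψ : ℂ → ℂ, DifferentiableOn ℂ ψ (ball (0:ℂ) 1) ∧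
        Set.MapsTo ψ (ball (0:ℂ) 1) (ball (0:ℂ) 1) ∧
        (∀ z ∈ ball (0:ℂ) 1, ψ (φ z) = z) ∧ (∀ z ∈ ball (0:ℂ) 1, φ (ψ z) = z))
    (hw : DifferentiableOn ℂ w (ball (0:ℂ) 1))
    (hw0 : w 0 = 1) :
    ∃ wtilde : ℂ → ℂ, DifferentiableOn ℂ wtilde (ball (0:ℂ) 1) ∧
      TendstoLocallyUniformlyOn
        (fun (n : ℕ) (z : ℂ) => ∏ j ∈ Finset.range n, w (φ^[j] z))
        wtilde atTop (ball (0:ℂ) 1) ∧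
      ∀ f : ℂ → ℂ, DifferentiableOn ℂ f (ball (0:ℂ) 1) →
        (∀ z ∈ ball (0:ℂ) 1, f z = w z * f (φ z)) →
        ∀ z ∈ ball (0:ℂ) 1, f z = f 0 * wtilde z := by
  have hlt := aux_key φ w hφ hφmaps hφ0 hnotaut
  have hit : ∀ n : ℕ, Set.MapsTo φ^[n] (ball (0:ℂ) 1) (ball (0:ℂ) 1) := fun n => hφmaps.iterate n
  have hitd : ∀ n : ℕ, DifferentiableOn ℂ φ^[n] (ball (0:ℂ) 1) := fun n => hφ.iterate hφmaps n
  have hwd : ∀ n : ℕ, DifferentiableOn ℂ (fun z => w (φ^[n] z)) (ball (0:ℂ) 1) :=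
    fun n => hw.comp (hitd n) (hit n)
  have hprod : HasProdLocallyUniformlyOn (fun (n : ℕ) z => 1 + (w (φ^[n] z) - 1))
      (fun z => ∏' n : ℕ, (1 + (w (φ^[n] z) - 1))) (ball (0:ℂ) 1) := by
    apply hasProdLocallyUniformlyOn_of_forall_compact isOpen_ball
    intro K hK hKc
    obtain ⟨r', hr', hKr'⟩ := exists_lt_subset_ball hKc.isClosed hK
    obtain ⟨δ, hδ0, hδ1, hδ⟩ := aux_bound φ hφ hφ0 hlt (max r' 0) (le_max_right _ _)
      (max_lt hr' one_pos)
    set r := max r' 0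
    have hr : r < 1 := max_lt hr' one_pos
    have hr0 : 0 ≤ r := le_max_right _ _
    have hKr : K ⊆ closedBall (0:ℂ) r := fun x hx =>
      closedBall_subset_closedBall (le_max_left _ _) (ball_subset_closedBall (hKr' hx))
    have hsub : closedBall (0:ℂ) r ⊆ ball 0 1 := closedBall_subset_ball hr
    have hd : ContinuousOn (dslope w 0) (closedBall (0:ℂ) r) :=
      (((Complex.differentiableOn_dslope (isOpen_ball.mem_nhds (mem_ball_self one_pos))).mpr
        hw).continuousOn).mono hsub
    obtain ⟨C, hC⟩ := (isCompact_closedBall (0:ℂ) r).exists_bound_of_continuousOn hd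
    have hu : Summable (fun n : ℕ => δ ^ n * r * C) :=
      ((summable_geometric_of_lt_one hδ0 hδ1).mul_right r).mul_right C
    refine hu.hasProdUniformlyOn_nat_one_add hKc (.of_forall fun n z hz => ?_) fun n =>
      (((hwd n).continuousOn).mono hK).sub continuousOn_const
    have h1 := hδ n z (hKr hz)
    have hmem : φ^[n] z ∈ closedBall (0:ℂ) r := by
      simpa using h1.trans (mul_le_of_le_one_left hr0 (pow_le_one₀ hδ0 hδ1.le))
    have h3 := sub_smul_dslope w 0 (φ^[n] z)
    simp only [hw0, sub_zero, smul_eq_mul] at h3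
    rw [← h3, norm_mul]
    exact mul_le_mul h1 (hC _ hmem) (norm_nonneg _) (by positivity)
  simp only [add_sub_cancel] at hprod
  have ht := hprod.tendstoLocallyUniformlyOn_finsetRange
  refine ⟨fun z => ∏' n : ℕ, w (φ^[n] z), ?_, ht, ?_⟩
  · refine ht.differentiableOn (.of_forall fun n => ?_) isOpen_ball
    exact DifferentiableOn.fun_finsetProd fun j _ => hwd j
  · intro f hf hfe z hz
    have hiter : ∀ n : ℕ, f z = (∏ j ∈ Finset.range n, w (φ^[j] z)) * f (φ^[n] z) := by
      intro n
      induction n with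
      | zero => simp
      | succ n ih =>
        rw [Finset.prod_range_succ, Function.iterate_succ_apply', mul_assoc,
          ← hfe _ (hit n hz), ← ih]
    have hz1 : ‖z‖ < 1 := by simpa using hz
    obtain ⟨δ, hδ0, hδ1, hδ⟩ := aux_bound φ hφ hφ0 hlt ‖z‖ (norm_nonneg _) hz1
    have hφt : Tendsto (fun n : ℕ => φ^[n] z) atTop (𝓝 0) := by
      refine squeeze_zero_norm (fun n => hδ n z (by simp)) ?_
      simpa using (tendsto_pow_atTop_nhds_zero_of_lt_one hδ0 hδ1).mul_const ‖z‖
    have hfc : ContinuousAt f 0 :=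
      (hf.differentiableAt (isOpen_ball.mem_nhds (mem_ball_self one_pos))).continuousAt
    have hlim := (ht.tendsto_at hz).mul (hfc.tendsto.comp hφt)
    have hconst : Tendsto (fun _ : ℕ => f z) atTop (𝓝 (f z)) := tendsto_const_nhds
    have := tendsto_nhds_unique (hconst.congr hiter) hlim
    rw [this, mul_comm]
end

section
/- Let λ ∈ ℂ be a primitive k-th root of unity, let φ(z) = λz, let w ∈ H^∞, and set v(z) = w(z)·w(λz)⋯w(λ^{k−1}z) for z ∈ 𝔻. Consider the weighted composition operator T_{w,φ} on the Hardy space H². (i) If ‖v‖_∞ < 1, then ‖T_{w,φ}ⁿ‖ → 0 as n → ∞. (ii) If ‖v‖_∞ > 1, then the sequence (T_{w,φ}ⁿ) does not converge weakly. -/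
open Complex Metric Filter Topology

/-- The Hardy space `H²`, realized as the sequence space `ℓ²` of Taylor coefficients. -/
noncomputable abbrev H2 : Type := lp (fun _ : ℕ => ℂ) 2

/-- Evaluation of an element of `H²` (a coefficient sequence) at a point of the disc. -/
noncomputable def H2.eval (f : H2) (z : ℂ) : ℂ := ∑' n : ℕ, f n * z ^ n

lemma aux_summable (f : H2) {z : ℂ} (hz : ‖z‖ < 1) : Summable (fun n : ℕ => ‖f n * z ^ n‖) := by
  refine Summable.of_nonneg_of_le (fun _ => norm_nonneg _) (fun n => ?_)
    ((summable_geometric_of_lt_one (norm_nonneg z) hz).mul_left ‖f‖)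
  rw [norm_mul, norm_pow]
  gcongr
  exact lp.norm_apply_le_norm (by norm_num) f n

lemma aux_parseval {E : Type*} [NormedAddCommGroup E] [InnerProductSpace ℂ E] {u : ℕ → E}
    (hu : Orthonormal ℂ u) (a : ℕ → ℂ) (x : E) (h : HasSum (fun n => a n • u n) x) :
    HasSum (fun n => ‖a n‖ ^ 2) (‖x‖ ^ 2) := by
  have h2 : Tendsto (fun s : Finset ℕ => ‖∑ n ∈ s, a n • u n‖ ^ 2) atTop (𝓝 (‖x‖ ^ 2)) :=
    (Tendsto.norm h).pow 2
  refine h2.congr (fun s => ?_)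
  have := hu.orthogonalFamily.norm_sum a s
  simpa using this

lemma aux_iter (lam : ℂ) (hl : ‖lam‖ = 1) (w : ℂ → ℂ) (T : H2 →L[ℂ] H2)
    (hT : ∀ (f : H2), ∀ z ∈ ball (0:ℂ) 1, H2.eval (T f) z = w z * H2.eval f (lam * z))
    (n : ℕ) (f : H2) (z : ℂ) (hz : z ∈ ball (0:ℂ) 1) :
    H2.eval ((T ^ n) f) z = (∏ j ∈ Finset.range n, w (lam ^ j * z)) * H2.eval f (lam ^ n * z) := by
  induction n generalizing f with
  | zero => simp
  | succ n ih =>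
    have : (T ^ (n+1)) f = (T ^ n) (T f) := by rw [pow_succ]; rfl
    rw [this, ih, hT _ _ (by simpa [hl] using hz), Finset.prod_range_succ, pow_succ', mul_assoc,
      mul_assoc]

lemma aux_circle (f : H2) {r : ℝ} (h0 : 0 ≤ r) (h1 : r < 1) :
    ∃ G : C(AddCircle (1:ℝ), ℂ),
      (∀ t, G t = H2.eval f (r * fourier 1 t)) ∧
      HasSum (fun n => ‖f n * (r:ℂ) ^ n‖ ^ 2)
        (‖ContinuousMap.toLp (E := ℂ) 2 AddCircle.haarAddCircle ℂ G‖ ^ 2) := by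
  have hz : ‖(r:ℂ)‖ < 1 := by simpa [abs_of_nonneg h0] using h1
  have hs : Summable (fun n : ℕ => (f n * (r:ℂ) ^ n) • (fourier (T := (1:ℝ)) (n:ℤ))) := by
    refine Summable.of_norm ?_
    simpa [norm_smul, fourier_norm] using aux_summable f hz
  refine ⟨∑' n : ℕ, (f n * (r:ℂ) ^ n) • (fourier (T := (1:ℝ)) (n:ℤ)), fun t => ?_,
    aux_parseval (u := fun n : ℕ => fourierLp (T := (1:ℝ)) 2 (n:ℤ)) ?_ _ _ ?_⟩
  · rw [← ContinuousMap.tsum_apply hs]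
    unfold H2.eval
    refine tsum_congr fun n => ?_
    simp [fourier_apply, mul_pow, mul_assoc, AddCircle.toCircle_nsmul]
  · exact orthonormal_fourier.comp _ Nat.cast_injective
  · have := (ContinuousMap.toLp (E := ℂ) 2 (AddCircle.haarAddCircle (T := (1:ℝ))) ℂ).hasSum hs.hasSum
    simpa [fourierLp] using this

lemma aux_mul (v : ℂ → ℂ) (s : ℝ) (hs : 0 ≤ s) (hv : ∀ z ∈ ball (0:ℂ) 1, ‖v z‖ ≤ s)
    (f g : H2) (h : ∀ z ∈ ball (0:ℂ) 1, H2.eval g z = v z * H2.eval f z) :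
    ‖g‖ ≤ s * ‖f‖ := by
  have hn : ∀ f : H2, HasSum (fun n => ‖f n‖ ^ 2) (‖f‖ ^ 2) := by
    intro f
    have := lp.hasSum_norm (p := 2) (by norm_num) f
    simpa using this
  have key : ∀ r : ℝ, 0 ≤ r → r < 1 → ∀ S : Finset ℕ,
      ∑ n ∈ S, (‖g n‖ * r ^ n) ^ 2 ≤ (s * ‖f‖) ^ 2 := by
    intro r h0 h1 S
    obtain ⟨F, hF, hF'⟩ := aux_circle f h0 h1
    obtain ⟨G, hG, hG'⟩ := aux_circle g h0 h1
    have e1 : ‖ContinuousMap.toLp (E := ℂ) 2 AddCircle.haarAddCircle ℂ G‖ ≤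
        s * ‖ContinuousMap.toLp (E := ℂ) 2 AddCircle.haarAddCircle ℂ F‖ := by
      apply MeasureTheory.Lp.norm_le_mul_norm_of_ae_le_mul
      filter_upwards [ContinuousMap.coeFn_toLp (p := 2) (𝕜 := ℂ) AddCircle.haarAddCircle F,
        ContinuousMap.coeFn_toLp (p := 2) (𝕜 := ℂ) AddCircle.haarAddCircle G] with t ht1 ht2
      have hb : (r:ℂ) * fourier 1 t ∈ ball (0:ℂ) 1 := by
        have ht : ‖fourier 1 t‖ = 1 := by rw [fourier_apply]; exact Circle.norm_coe _
        rw [mem_ball_zero_iff, norm_mul, ht, norm_real, Real.norm_of_nonneg h0, mul_one]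
        exact h1
      rw [ht1, ht2, hF, hG, h _ hb, norm_mul]
      gcongr
      exact hv _ hb
    have e2 : ‖ContinuousMap.toLp (E := ℂ) 2 AddCircle.haarAddCircle ℂ F‖ ^ 2 ≤ ‖f‖ ^ 2 := by
      refine hasSum_le (fun n => ?_) hF' (hn f)
      rw [norm_mul, norm_pow, norm_real, Real.norm_of_nonneg h0]
      gcongr
      exact mul_le_of_le_one_right (norm_nonneg _) (pow_le_one₀ h0 h1.le)
    have e3 := sum_le_hasSum S (fun _ _ => by positivity) hG'
    calc _ = ∑ n ∈ S, ‖g n * (r:ℂ) ^ n‖ ^ 2 := by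
            simp [Real.norm_of_nonneg h0]
      _ ≤ _ := e3
      _ ≤ (s * ‖ContinuousMap.toLp (E := ℂ) 2 AddCircle.haarAddCircle ℂ F‖) ^ 2 := by gcongr
      _ ≤ _ := by rw [mul_pow, mul_pow]; gcongr
  have key2 : ∀ S : Finset ℕ, ∑ n ∈ S, ‖g n‖ ^ 2 ≤ (s * ‖f‖) ^ 2 := by
    intro S
    have hc : Tendsto (fun r : ℝ => ∑ n ∈ S, (‖g n‖ * r ^ n) ^ 2) (𝓝[<] 1)
        (𝓝 (∑ n ∈ S, (‖g n‖ * (1:ℝ) ^ n) ^ 2)) := by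
      have : Continuous (fun r : ℝ => ∑ n ∈ S, (‖g n‖ * r ^ n) ^ 2) := by fun_prop
      exact this.continuousAt.tendsto.mono_left nhdsWithin_le_nhds
    have := le_of_tendsto hc (b := (s * ‖f‖) ^ 2) (by
      filter_upwards [Ioo_mem_nhdsLT (show (0:ℝ) < 1 by norm_num)] with r hr
      exact key r hr.1.le hr.2 S)
    simpa using this
  have := hasSum_le_of_sum_le (hn g) key2
  exact (sq_le_sq₀ (norm_nonneg _) (by positivity)).1 this

lemma aux_pow (k : ℕ) (hk : 0 < k) (T : H2 →L[ℂ] H2) (s : ℝ) (hs : 0 ≤ s) (hs1 : s < 1)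
    (h : ‖T ^ k‖ ≤ s) : Tendsto (fun n : ℕ => ‖T ^ n‖) atTop (𝓝 0) := by
  have hlim : Tendsto (fun n : ℕ => s ^ (n / k) * ∑ r ∈ Finset.range k, ‖T ^ r‖) atTop (𝓝 0) := by
    simpa using ((tendsto_pow_atTop_nhds_zero_of_lt_one hs hs1).comp
      (Nat.tendsto_div_const_atTop hk.ne')).mul_const (∑ r ∈ Finset.range k, ‖T ^ r‖)
  refine squeeze_zero (fun _ => norm_nonneg _) (fun n => ?_) hlim
  have : T ^ n = (T ^ k) ^ (n / k) * T ^ (n % k) := by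
    rw [← pow_mul, ← pow_add, Nat.div_add_mod]
  have : Nontrivial H2 := ⟨lp.single 2 0 1, 0, fun h => by
    have := congrArg (fun f : H2 => f 0) h
    simp at this⟩
  rw [‹T ^ n = _›]
  refine (norm_mul_le _ _).trans ?_
  gcongr
  · exact (norm_pow_le _ _).trans (by gcongr)
  · exact Finset.single_le_sum (f := fun r => ‖T ^ r‖) (fun _ _ => norm_nonneg _)
      (Finset.mem_range.2 (Nat.mod_lt _ hk))

/-- Let `λ` be a primitive `k`-th root of unity, `φ(z) = λz`, `w ∈ H^∞`,
and `v(z) = w(z)·w(λz)⋯w(λ^{k−1}z)`.  For the weighted composition operator `T_{w,φ}`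
on `H²`:  (i) if `‖v‖_∞ < 1` then `‖T_{w,φ}ⁿ‖ → 0`, and (ii) if `‖v‖_∞ > 1` then
`(T_{w,φ}ⁿ)` does not converge weakly. -/
theorem iterates_elliptic_finite_order_sup_lt_one_or_gt_one
    (k : ℕ) (hk : 0 < k) (lam : ℂ) (hlam : IsPrimitiveRoot lam k)
    (w : ℂ → ℂ) (hw : DifferentiableOn ℂ w (ball (0:ℂ) 1))
    (hwb : ∃ M : ℝ, ∀ z ∈ ball (0:ℂ) 1, ‖w z‖ ≤ M)
    (v : ℂ → ℂ) (hv : ∀ z : ℂ, v z = ∏ j ∈ Finset.range k, w (lam ^ j * z))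
    (T : H2 →L[ℂ] H2)
    (hT : ∀ (f : H2), ∀ z ∈ ball (0:ℂ) 1, H2.eval (T f) z = w z * H2.eval f (lam * z)) :
    (sSup {r : ℝ | ∃ z ∈ ball (0:ℂ) 1, r = ‖v z‖} < 1 →
        Tendsto (fun n : ℕ => ‖T ^ n‖) atTop (𝓝 0)) ∧
    (1 < sSup {r : ℝ | ∃ z ∈ ball (0:ℂ) 1, r = ‖v z‖} →
        ¬ ∀ f : H2, ∃ g : H2, ∀ h : H2,
            Tendsto (fun n : ℕ => (inner ℂ ((T ^ n) f) h : ℂ)) atTop (𝓝 (inner ℂ g h))) := by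
  have hl : ‖lam‖ = 1 := hlam.norm'_eq_one hk.ne'
  have hM : ∀ (f : H2), ∀ z ∈ ball (0:ℂ) 1, H2.eval ((T ^ k) f) z = v z * H2.eval f z := by
    intro f z hz
    rw [aux_iter lam hl w T hT k f z hz, hlam.pow_eq_one, one_mul, hv]
  constructor
  · intro hlt
    obtain ⟨M, hMb⟩ := hwb
    have hbdd : BddAbove {r : ℝ | ∃ z ∈ ball (0:ℂ) 1, r = ‖v z‖} := by
      refine ⟨M ^ k, ?_⟩
      rintro r ⟨z, hz, rfl⟩
      rw [hv, norm_prod]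
      calc _ ≤ ∏ j ∈ Finset.range k, M := by
            refine Finset.prod_le_prod (fun _ _ => norm_nonneg _) (fun j _ => hMb _ ?_)
            simpa [hl] using hz
        _ = _ := by simp
    have hle : ∀ z ∈ ball (0:ℂ) 1, ‖v z‖ ≤ sSup {r : ℝ | ∃ z ∈ ball (0:ℂ) 1, r = ‖v z‖} :=
      fun z hz => le_csSup hbdd ⟨z, hz, rfl⟩
    have h0 : 0 ≤ sSup {r : ℝ | ∃ z ∈ ball (0:ℂ) 1, r = ‖v z‖} :=
      (norm_nonneg _).trans (hle 0 (by simp))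
    refine aux_pow k hk T _ h0 hlt (ContinuousLinearMap.opNorm_le_bound _ h0 fun f => ?_)
    exact aux_mul v _ h0 hle f _ (hM f)
  · intro hgt hcon
    obtain ⟨_, ⟨z, hz, rfl⟩, hz1⟩ := exists_lt_of_lt_csSup (⟨_, 0, by simp, rfl⟩ : {r : ℝ | ∃ z ∈ ball (0:ℂ) 1, r = ‖v z‖}.Nonempty) hgt
    have hz' : ‖z‖ < 1 := by simpa using hz
    have hmem : Memℓp (fun n : ℕ => (starRingEnd ℂ z) ^ n) 2 := by
      apply memℓp_gen
      have : Summable (fun n : ℕ => (‖z‖ ^ 2) ^ n) :=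
        summable_geometric_of_lt_one (by positivity) (by nlinarith [norm_nonneg z])
      refine this.congr fun n => ?_
      simp [← pow_mul, mul_comm]
    let h : H2 := ⟨fun n : ℕ => (starRingEnd ℂ z) ^ n, hmem⟩
    have hinner : ∀ f : H2, inner ℂ f h = starRingEnd ℂ (H2.eval f z) := by
      intro f
      rw [lp.inner_eq_tsum, H2.eval, Complex.conj_tsum]
      refine tsum_congr fun n => ?_
      simp [h, mul_comm]
    let f : H2 := lp.single 2 0 1
    have hf : H2.eval f z = 1 := by
      rw [H2.eval, tsum_eq_single 0]
      · simp [f]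
      · intro n hn
        simp [f, hn]
    have hp : ∀ n : ℕ, H2.eval ((T ^ (k * n)) f) z = v z ^ n := by
      intro n
      induction n with
      | zero => simp [hf]
      | succ n ih =>
        have : (T ^ (k * (n+1))) f = (T ^ k) ((T ^ (k * n)) f) := by
          rw [mul_add, mul_one, add_comm, pow_add]; rfl
        rw [this, hM _ _ hz, ih, pow_succ']
    obtain ⟨g, hg⟩ := hcon f
    have h1 := ((hg h).norm).comp (tendsto_id.const_mul_atTop' hk)
    have h2 : Tendsto (fun n : ℕ => ‖v z‖ ^ n) atTop (𝓝 ‖inner ℂ g h‖) := by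
      refine h1.congr fun n => ?_
      simp only [Function.comp, id]
      rw [hinner, hp, RCLike.norm_conj, norm_pow]
    exact not_tendsto_nhds_of_tendsto_atTop (tendsto_pow_atTop_atTop_of_one_lt hz1) _ h2
end

section
/- Let λ ∈ ℂ be a primitive k-th root of unity, let φ(z) = λz, let w ∈ H^∞, and set v(z) = w(z)·w(λz)⋯w(λ^{k−1}z). Suppose ‖v‖_∞ = 1, v is non-constant, and the radial boundary values of v satisfy |v| < 1 almost everywhere on the unit circle 𝕋. Then T_{w,φ}ⁿ → 0 strongly on the Hardy space H² (i.e. ‖T_{w,φ}ⁿ f‖₂ → 0 for every f ∈ H²), but T_{w,φ}ⁿ does not converge to 0 in operator norm. -/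
open Complex Metric Filter Topology MeasureTheory

open scoped Real

lemma H2.coeff_le (g : H2) (n : ℕ) : ‖g n‖ ≤ ‖g‖ :=
  lp.norm_apply_le_norm (by norm_num) g n

lemma H2.summable_bound (g : H2) {r : ℝ} (h0 : 0 ≤ r) (h1 : r < 1) :
    Summable (fun n : ℕ => ‖g‖ * r ^ n) :=
  (summable_geometric_of_lt_one h0 h1).mul_left _

lemma H2.term_le (g : H2) (z : ℂ) (n : ℕ) : ‖g n * z ^ n‖ ≤ ‖g‖ * ‖z‖ ^ n := by
  rw [norm_mul, norm_pow]
  exact mul_le_mul_of_nonneg_right (g.coeff_le n) (by positivity)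

lemma H2.hasSum_eval (g : H2) {z : ℂ} (hz : ‖z‖ < 1) :
    HasSum (fun n : ℕ => g n * z ^ n) (H2.eval g z) :=
  (Summable.of_norm_bounded (g.summable_bound (norm_nonneg z) hz) (g.term_le z)).hasSum

lemma H2.eval_le (g : H2) {z : ℂ} (hz : ‖z‖ < 1) :
    ‖H2.eval g z‖ ≤ ‖g‖ * (1 - ‖z‖)⁻¹ := by
  refine tsum_of_norm_bounded ((hasSum_geometric_of_lt_one (norm_nonneg z) hz).mul_left _) (g.term_le z)

lemma norm_circ (r θ : ℝ) (h0 : 0 ≤ r) : ‖(r : ℂ) * Complex.exp (θ * Complex.I)‖ = r := by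
  simp [Complex.norm_exp_ofReal_mul_I, abs_of_nonneg h0]

lemma H2.continuous_circ (g : H2) {r : ℝ} (h0 : 0 ≤ r) (h1 : r < 1) :
    Continuous (fun θ : ℝ => H2.eval g ((r : ℂ) * Complex.exp (θ * Complex.I))) := by
  unfold H2.eval
  refine continuous_tsum (fun n => by fun_prop) (g.summable_bound h0 h1) (fun n θ => ?_)
  have := g.term_le ((r : ℂ) * Complex.exp (θ * Complex.I)) n
  rwa [norm_circ r θ h0] at this

noncomputable def H2.J (g : H2) (r : ℝ) : ℝ :=
  (2 * π)⁻¹ * ∫ θ in (0:ℝ)..(2 * π), ‖H2.eval g ((r : ℂ) * Complex.exp (θ * Complex.I))‖ ^ 2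

lemma poly_parseval (c : ℕ → ℂ) (N : ℕ) :
    ∑ i ∈ Finset.range N, ‖c i‖ ^ 2 =
      (2 * π)⁻¹ * ∫ θ in (0:ℝ)..(2 * π),
        ‖∑ i ∈ Finset.range N, c i * (Complex.exp (θ * Complex.I)) ^ i‖ ^ 2 := by
  set p : Polynomial ℂ := ∑ i ∈ Finset.range N, Polynomial.monomial i (c i) with hp
  have hc : ∀ j, p.coeff j = if j < N then c j else 0 := by
    intro j
    simp [hp, Polynomial.coeff_monomial]
  have h := p.sum_sq_norm_coeff_eq_circleAverage
  have h2 : ∑ i ∈ p.support, ‖p.coeff i‖ ^ 2 = ∑ i ∈ Finset.range N, ‖c i‖ ^ 2 := by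
    rw [Finset.sum_subset (s₂ := Finset.range N)]
    · refine Finset.sum_congr rfl fun i hi => ?_
      rw [hc, if_pos (Finset.mem_range.1 hi)]
    · intro i hi
      rw [Polynomial.mem_support_iff, hc] at hi
      by_contra h
      simp at h
      simp [not_lt.2 h] at hi
    · intro i _ hi
      rw [Polynomial.notMem_support_iff] at hi
      simp [hi]
  rw [← h2, h, Real.circleAverage_def, smul_eq_mul]
  simp [hp, Polynomial.eval_finsetSum, circleMap]

lemma H2.parseval (g : H2) {r : ℝ} (h0 : 0 ≤ r) (h1 : r < 1) :
    Tendsto (fun N : ℕ => ∑ i ∈ Finset.range N, ‖g i * (r:ℂ) ^ i‖ ^ 2) atTop (𝓝 (g.J r)) := by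
  simp_rw [poly_parseval]
  refine Tendsto.const_mul _ ?_
  refine intervalIntegral.tendsto_integral_filter_of_dominated_convergence
    (fun _ => (‖g‖ * (1 - r)⁻¹) ^ 2) (.of_forall fun N => ?_) (.of_forall fun N => .of_forall fun θ _ => ?_)
    intervalIntegrable_const (.of_forall fun θ _ => ?_)
  · exact Continuous.aestronglyMeasurable (by fun_prop)
  · rw [norm_pow, norm_norm]
    gcongr
    refine (norm_sum_le _ _).trans ?_
    rw [← tsum_geometric_of_lt_one h0 h1, ← tsum_mul_left]
    refine le_trans (Finset.sum_le_sum fun i _ => ?_)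
      ((g.summable_bound h0 h1).sum_le_tsum (Finset.range N) fun i _ => by positivity)
    have := g.term_le ((r : ℂ) * Complex.exp (θ * Complex.I)) i
    rwa [norm_circ r θ h0, mul_pow, ← mul_assoc] at this
  · have := (g.hasSum_eval (z := (r : ℂ) * Complex.exp (θ * Complex.I))
      (by rw [norm_circ r θ h0]; exact h1)).tendsto_sum_nat
    simp_rw [mul_pow, ← mul_assoc] at this
    exact (this.norm).pow 2

lemma H2.hasSum_sq (g : H2) : HasSum (fun n => ‖g n‖ ^ 2) (‖g‖ ^ 2) := by
  have := lp.hasSum_norm (p := 2) (by norm_num) g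
  simpa using this

lemma H2.partial_le_J (g : H2) {r : ℝ} (h0 : 0 ≤ r) (h1 : r < 1) (N : ℕ) :
    ∑ i ∈ Finset.range N, ‖g i * (r:ℂ) ^ i‖ ^ 2 ≤ g.J r := by
  refine Monotone.ge_of_tendsto ?_ (g.parseval h0 h1) N
  refine monotone_nat_of_le_succ fun n => ?_
  rw [Finset.sum_range_succ]
  exact le_add_of_nonneg_right (by positivity)

lemma H2.J_le (g : H2) {r : ℝ} (h0 : 0 ≤ r) (h1 : r < 1) : g.J r ≤ ‖g‖ ^ 2 := by
  refine le_of_tendsto_of_tendsto (g.parseval h0 h1) g.hasSum_sq.tendsto_sum_nat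
    (.of_forall fun N => Finset.sum_le_sum fun i _ => ?_)
  gcongr
  rw [norm_mul, norm_pow, Complex.norm_real, Real.norm_of_nonneg h0]
  exact mul_le_of_le_one_right (norm_nonneg _) (pow_le_one₀ h0 h1.le)

lemma ev_Ico : ∀ᶠ r : ℝ in 𝓝[<] (1:ℝ), 0 ≤ r ∧ r < 1 := by
  filter_upwards [Ico_mem_nhdsLT (show (0:ℝ) < 1 by norm_num)] with r hr using hr

lemma H2.norm_sq_le_of_tendsto (g : H2) {b : ℝ → ℝ} {B : ℝ}
    (hb : Tendsto b (𝓝[<] 1) (𝓝 B)) (h : ∀ r, 0 ≤ r → r < 1 → g.J r ≤ b r) : ‖g‖ ^ 2 ≤ B := by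
  refine le_of_tendsto' g.hasSum_sq.tendsto_sum_nat fun N => ?_
  have hc : Tendsto (fun r : ℝ => ∑ i ∈ Finset.range N, ‖g i * (r:ℂ) ^ i‖ ^ 2) (𝓝[<] 1)
      (𝓝 (∑ i ∈ Finset.range N, ‖g i‖ ^ 2)) := by
    have : Continuous (fun r : ℝ => ∑ i ∈ Finset.range N, ‖g i * (r:ℂ) ^ i‖ ^ 2) := by fun_prop
    have h := (this.tendsto 1).mono_left (nhdsWithin_le_nhds (s := Set.Iio 1))
    simpa using h
  refine le_of_tendsto_of_tendsto hc hb ?_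
  filter_upwards [ev_Ico] with r hr
  exact (g.partial_le_J hr.1 hr.2 N).trans (h r hr.1 hr.2)

lemma H2.norm_le_of_eval_le (g f : H2) (h : ∀ z : ℂ, ‖z‖ < 1 → ‖H2.eval g z‖ ≤ ‖H2.eval f z‖) :
    ‖g‖ ≤ ‖f‖ := by
  refine le_of_sq_le_sq ?_ (norm_nonneg _)
  refine g.norm_sq_le_of_tendsto (tendsto_const_nhds (x := ‖f‖ ^ 2)) fun r h0 h1 => ?_
  refine le_trans ?_ (f.J_le h0 h1)
  unfold H2.J
  refine mul_le_mul_of_nonneg_left ?_ (by positivity)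
  refine intervalIntegral.integral_mono_on (by positivity)
    (((g.continuous_circ h0 h1).norm.pow 2).intervalIntegrable _ _)
    (((f.continuous_circ h0 h1).norm.pow 2).intervalIntegrable _ _) fun θ _ => ?_
  gcongr
  exact h _ (by rw [norm_circ r θ h0]; exact h1)

lemma H2.eval_single (i : ℕ) (a z : ℂ) : H2.eval (lp.single 2 i a) z = a * z ^ i := by
  unfold H2.eval
  rw [tsum_eq_single i]
  · simp
  · intro j hj
    simp [Pi.single_eq_of_ne hj]

/-- strong convergence on monomials -/
lemma mono_tendsto (S : H2 →L[ℂ] H2) (v : ℂ → ℂ)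
    (hv1 : ∀ z : ℂ, ‖z‖ < 1 → ‖v z‖ ≤ 1)
    (hS : ∀ (m : ℕ) (f : H2) (z : ℂ), ‖z‖ < 1 → H2.eval ((S ^ m) f) z = v z ^ m * H2.eval f z)
    (vstar : ℝ → ℂ)
    (hrad : ∀ᵐ θ : ℝ, Tendsto (fun r : ℝ => v ((r : ℂ) * Complex.exp (θ * Complex.I)))
        (𝓝[<] (1:ℝ)) (𝓝 (vstar θ)))
    (hlt : ∀ᵐ θ : ℝ, ‖vstar θ‖ < 1) (i : ℕ) (a : ℂ) :
    Tendsto (fun m : ℕ => (S ^ m) (lp.single 2 i a : H2)) atTop (𝓝 0) := by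
  have hmeas : AEStronglyMeasurable vstar (volume : Measure ℝ) := by
    have : ∀ᶠ r : ℝ in 𝓝[<] (1:ℝ), 0 ≤ r ∧ r < 1 := ev_Ico
    refine aestronglyMeasurable_of_tendsto_ae (μ := (volume : Measure ℝ)) (𝓝[<] (1:ℝ)) (g := vstar)
      (f := fun (r : ℝ) θ => if 0 ≤ r ∧ r < 1 then v ((r : ℂ) * Complex.exp (θ * Complex.I)) else 0)
      (fun r => ?_) ?_
    · by_cases hr : 0 ≤ r ∧ r < 1
      · simp only [hr, and_self, if_true]
        have h := ((S ^ 1) (lp.single 2 0 1 : H2)).continuous_circ hr.1 hr.2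
        refine Continuous.aestronglyMeasurable (h.congr fun θ => ?_)
        rw [hS _ _ _ (by rw [norm_circ r θ hr.1]; exact hr.2), H2.eval_single]
        simp
      · simp only [hr, if_false]
        exact aestronglyMeasurable_const
    · filter_upwards [hrad] with θ hθ
      refine hθ.congr' ?_
      filter_upwards [this] with r hr
      simp [hr]
  have hle : ∀ m : ℕ, ‖(S ^ m) (lp.single 2 i a : H2)‖ ^ 2 ≤ (2 * π)⁻¹ *
      ∫ θ in (0:ℝ)..(2 * π), ‖vstar θ ^ m * (a * Complex.exp (θ * Complex.I) ^ i)‖ ^ 2 := by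
    intro m
    refine H2.norm_sq_le_of_tendsto _ (b := H2.J _) ?_ (fun _ _ _ => le_rfl)
    refine Tendsto.const_mul _ ?_
    refine intervalIntegral.tendsto_integral_filter_of_dominated_convergence
      (fun _ => ‖a‖ ^ 2) ?_ ?_ intervalIntegrable_const ?_
    · filter_upwards [ev_Ico] with r hr
      exact ((H2.continuous_circ _ hr.1 hr.2).norm.pow 2).aestronglyMeasurable
    · filter_upwards [ev_Ico] with r hr
      refine .of_forall fun θ _ => ?_
      have hz : ‖(r : ℂ) * Complex.exp (θ * Complex.I)‖ < 1 := by
        rw [norm_circ r θ hr.1]; exact hr.2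
      rw [hS _ _ _ hz, H2.eval_single, norm_pow, norm_norm]
      gcongr
      rw [norm_mul, norm_mul, norm_pow, norm_pow]
      calc _ ≤ 1 * (‖a‖ * 1) := by
            gcongr
            · exact pow_le_one₀ (norm_nonneg _) (hv1 _ hz)
            · exact pow_le_one₀ (norm_nonneg _) hz.le
        _ = ‖a‖ := by ring
    · filter_upwards [hrad] with θ hθ _
      have h1 : Tendsto (fun r : ℝ => (r : ℂ) * Complex.exp (θ * Complex.I)) (𝓝[<] (1:ℝ))
          (𝓝 (Complex.exp (θ * Complex.I))) := by
        have : Continuous (fun r : ℝ => (r : ℂ) * Complex.exp (θ * Complex.I)) := by fun_prop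
        simpa using (this.tendsto 1).mono_left (nhdsWithin_le_nhds (s := Set.Iio 1))
      refine Tendsto.congr' ?_ (((hθ.pow m).mul ((h1.pow i).const_mul a)).norm.pow 2)
      filter_upwards [ev_Ico] with r hr
      have hz : ‖(r : ℂ) * Complex.exp (θ * Complex.I)‖ < 1 := by
        rw [norm_circ r θ hr.1]; exact hr.2
      rw [hS _ _ _ hz, H2.eval_single]
  have hlim : Tendsto (fun m : ℕ => (2 * π)⁻¹ *
      ∫ θ in (0:ℝ)..(2 * π), ‖vstar θ ^ m * (a * Complex.exp (θ * Complex.I) ^ i)‖ ^ 2)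
      atTop (𝓝 ((2 * π)⁻¹ * ∫ θ in (0:ℝ)..(2 * π), (0:ℝ))) := by
    refine Tendsto.const_mul _ ?_
    refine intervalIntegral.tendsto_integral_filter_of_dominated_convergence
      (fun _ => ‖a‖ ^ 2) (.of_forall fun m => ?_) (.of_forall fun m => ?_)
      intervalIntegrable_const ?_
    · have h2 : AEStronglyMeasurable (fun θ : ℝ => a * Complex.exp (θ * Complex.I) ^ i) volume :=
        Continuous.aestronglyMeasurable (by fun_prop)
      exact (((hmeas.pow m).mul h2).norm.pow 2).restrict
    · filter_upwards [hlt] with θ hθ _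
      rw [norm_pow, norm_norm]
      gcongr
      rw [norm_mul, norm_mul, norm_pow, norm_pow, Complex.norm_exp_ofReal_mul_I]
      simpa using mul_le_of_le_one_left (norm_nonneg a) (pow_le_one₀ (norm_nonneg _) hθ.le)
    · filter_upwards [hlt] with θ hθ _
      have h3 := (((tendsto_pow_atTop_nhds_zero_of_norm_lt_one hθ).mul_const
        (a * Complex.exp (θ * Complex.I) ^ i)).norm.pow 2)
      simpa using h3
  rw [tendsto_zero_iff_norm_tendsto_zero]
  have hsq : Tendsto (fun m : ℕ => ‖(S ^ m) (lp.single 2 i a : H2)‖ ^ 2) atTop (𝓝 0) := by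
    refine squeeze_zero (fun m => by positivity) hle (by simpa using hlim)
  have := hsq.sqrt
  simpa [Real.sqrt_sq] using this

lemma contr_tendsto (S : H2 →L[ℂ] H2) (hc : ∀ (m : ℕ) (f : H2), ‖(S ^ m) f‖ ≤ ‖f‖)
    (hs : ∀ (i : ℕ) (a : ℂ), Tendsto (fun m : ℕ => (S ^ m) (lp.single 2 i a : H2)) atTop (𝓝 0))
    (f : H2) : Tendsto (fun m : ℕ => (S ^ m) f) atTop (𝓝 0) := by
  rw [Metric.tendsto_atTop]
  intro ε hε
  have hf := lp.hasSum_single (p := 2) (by norm_num) f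
  rw [HasSum, Metric.tendsto_nhds] at hf
  obtain ⟨s, hs'⟩ := (hf (ε / 2) (by positivity)).exists
  set p : H2 := ∑ i ∈ s, lp.single 2 i (f i) with hp
  have h1 : Tendsto (fun m : ℕ => (S ^ m) p) atTop (𝓝 0) := by
    simp only [hp, map_sum]
    simpa using tendsto_finsetSum s fun i _ => hs i (f i)
  rw [Metric.tendsto_atTop] at h1
  obtain ⟨N, hN⟩ := h1 (ε / 2) (by positivity)
  refine ⟨N, fun m hm => ?_⟩
  have h2 := hN m hm
  rw [dist_zero_right] at h2 ⊢
  have h3 := hc m (f - p)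
  rw [map_sub] at h3
  rw [dist_comm, dist_eq_norm] at hs'
  have h4 : ‖(S ^ m) f‖ ≤ ‖(S ^ m) f - (S ^ m) p‖ + ‖(S ^ m) p‖ := by
    simpa using norm_add_le ((S ^ m) f - (S ^ m) p) ((S ^ m) p)
  linarith

/-- Let `λ` be a primitive `k`-th root of unity, `φ(z) = λz`, `w ∈ H^∞`,
`v(z) = w(z)·w(λz)⋯w(λ^{k−1}z)`.  Suppose `‖v‖_∞ = 1`, `v` is non-constant, and the
radial boundary values of `v` satisfy `|v| < 1` almost everywhere on the circle.  Then
`T_{w,φ}ⁿ → 0` strongly on `H²`, but not in operator norm. -/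
theorem strong_but_not_uniform_convergence_of_boundary_values_lt_one
    (k : ℕ) (hk : 0 < k) (lam : ℂ) (hlam : IsPrimitiveRoot lam k)
    (w : ℂ → ℂ) (hw : DifferentiableOn ℂ w (ball (0:ℂ) 1))
    (hwb : ∃ M : ℝ, ∀ z ∈ ball (0:ℂ) 1, ‖w z‖ ≤ M)
    (v : ℂ → ℂ) (hv : ∀ z : ℂ, v z = ∏ j ∈ Finset.range k, w (lam ^ j * z))
    (hsup : sSup {r : ℝ | ∃ z ∈ ball (0:ℂ) 1, r = ‖v z‖} = 1)
    (hnonconst : ∃ z₁ ∈ ball (0:ℂ) 1, ∃ z₂ ∈ ball (0:ℂ) 1, v z₁ ≠ v z₂)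
    (vstar : ℝ → ℂ)
    (hrad : ∀ᵐ θ : ℝ, Tendsto (fun r : ℝ => v ((r : ℂ) * Complex.exp (θ * Complex.I)))
        (𝓝[<] (1:ℝ)) (𝓝 (vstar θ)))
    (hlt : ∀ᵐ θ : ℝ, ‖vstar θ‖ < 1)
    (T : H2 →L[ℂ] H2)
    (hT : ∀ (f : H2), ∀ z ∈ ball (0:ℂ) 1, H2.eval (T f) z = w z * H2.eval f (lam * z)) :
    (∀ f : H2, Tendsto (fun n : ℕ => ‖(T ^ n) f‖) atTop (𝓝 0)) ∧
    ¬ Tendsto (fun n : ℕ => ‖T ^ n‖) atTop (𝓝 0) := by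
  have hl1 : ‖lam‖ = 1 := hlam.norm'_eq_one hk.ne'
  have hlz : ∀ (n : ℕ) (z : ℂ), ‖lam ^ n * z‖ = ‖z‖ := fun n z => by
    rw [norm_mul, norm_pow, hl1]; simp
  have hTn : ∀ (n : ℕ) (f : H2) (z : ℂ), ‖z‖ < 1 → H2.eval ((T ^ n) f) z =
      (∏ j ∈ Finset.range n, w (lam ^ j * z)) * H2.eval f (lam ^ n * z) := by
    intro n
    induction n with
    | zero => intro f z _; simp
    | succ n ih =>
      intro f z hz
      rw [pow_succ, mul_apply_eq_comp, ih _ _ hz,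
        hT _ _ (by rw [mem_ball_zero_iff, hlz]; exact hz), Finset.prod_range_succ, pow_succ' lam,
        mul_assoc, mul_assoc lam]
  have hS : ∀ (m : ℕ) (f : H2) (z : ℂ), ‖z‖ < 1 →
      H2.eval (((T ^ k) ^ m) f) z = v z ^ m * H2.eval f z := by
    intro m
    induction m with
    | zero => intro f z _; simp
    | succ m ih =>
      intro f z hz
      rw [pow_succ, mul_apply_eq_comp, ih _ _ hz, hTn _ _ _ hz, hlam.pow_eq_one,
        one_mul, ← hv, pow_succ]
      ring
  have hv1 : ∀ z : ℂ, ‖z‖ < 1 → ‖v z‖ ≤ 1 := by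
    intro z hz
    rw [← hsup]
    obtain ⟨M, hM⟩ := hwb
    refine le_csSup ⟨M ^ k, ?_⟩ ⟨z, mem_ball_zero_iff.2 hz, rfl⟩
    rintro _ ⟨y, hy, rfl⟩
    rw [hv, norm_prod]
    calc _ ≤ ∏ j ∈ Finset.range k, M := Finset.prod_le_prod (fun _ _ => norm_nonneg _)
            fun j _ => hM _ (by rw [mem_ball_zero_iff, hlz]; exact mem_ball_zero_iff.1 hy)
      _ = M ^ k := by simp
  constructor
  · intro f
    have hc : ∀ (m : ℕ) (f : H2), ‖((T ^ k) ^ m) f‖ ≤ ‖f‖ := by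
      intro m f
      refine H2.norm_le_of_eval_le _ _ fun z hz => ?_
      rw [hS _ _ _ hz, norm_mul, norm_pow]
      exact mul_le_of_le_one_left (norm_nonneg _) (pow_le_one₀ (norm_nonneg _) (hv1 z hz))
    have h1 := (contr_tendsto (T ^ k) hc (mono_tendsto (T ^ k) v hv1 hS vstar hrad hlt) f).norm
    rw [norm_zero] at h1
    have h2 := (h1.comp (Nat.tendsto_div_const_atTop hk.ne')).const_mul
      (∑ j ∈ Finset.range k, ‖T ^ j‖)
    rw [mul_zero] at h2
    refine squeeze_zero (fun n => norm_nonneg _) (fun n => ?_) h2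
    have h3 : (T ^ n) f = (T ^ (n % k)) (((T ^ k) ^ (n / k)) f) := by
      rw [← mul_apply_eq_comp, ← pow_mul, ← pow_add, Nat.mod_add_div]
    rw [h3]
    refine (ContinuousLinearMap.le_opNorm _ _).trans ?_
    refine mul_le_mul_of_nonneg_right ?_ (norm_nonneg _)
    exact Finset.single_le_sum (f := fun j => ‖T ^ j‖) (fun _ _ => norm_nonneg _)
      (Finset.mem_range.2 (Nat.mod_lt n hk))
  · intro hlim
    have hev := hlim.eventually (gt_mem_nhds (show (0:ℝ) < 1 / 2 by norm_num))
    obtain ⟨N, hN⟩ := eventually_atTop.1 hev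
    set m := N + 1 with hm
    have hSm : ‖(T ^ k) ^ m‖ ≤ 1 / 2 := by
      rw [← pow_mul]
      refine (hN _ ?_).le
      nlinarith
    have key : ∀ z : ℂ, ‖z‖ < 1 → ‖v z‖ ^ m ≤ 1 / 2 := by
      intro z hz
      by_contra! hcon
      have hgt : 1 < 2 * ‖v z‖ ^ m := by linarith
      have hbd : ∀ j : ℕ, (2 * ‖v z‖ ^ m) ^ j ≤ ‖(lp.single 2 0 1 : H2)‖ * (1 - ‖z‖)⁻¹ := by
        intro j
        have h1 := hS (m * j) (lp.single 2 0 1) z hz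
        have h2 := H2.eval_le (((T ^ k) ^ (m * j)) (lp.single 2 0 1)) hz
        rw [h1, H2.eval_single, pow_zero, mul_one, mul_one, norm_pow, pow_mul] at h2
        have h3 : ‖((T ^ k) ^ (m * j)) (lp.single 2 0 1 : H2)‖ ≤
            (1 / 2) ^ j * ‖(lp.single 2 0 1 : H2)‖ := by
          refine (ContinuousLinearMap.le_opNorm _ _).trans ?_
          refine mul_le_mul_of_nonneg_right ?_ (norm_nonneg _)
          rw [pow_mul]
          rcases Nat.eq_zero_or_pos j with rfl | hj
          · simpa using! ContinuousLinearMap.norm_id_le (𝕜 := ℂ) (E := H2)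
          · exact (norm_pow_le' _ hj).trans (pow_le_pow_left₀ (norm_nonneg _) hSm j)
        have hpos : 0 < (1 - ‖z‖)⁻¹ := inv_pos.2 (by linarith)
        have h4 := h2.trans (mul_le_mul_of_nonneg_right h3 hpos.le)
        rw [mul_pow]
        calc 2 ^ j * (‖v z‖ ^ m) ^ j ≤ 2 ^ j * ((1 / 2) ^ j * ‖(lp.single 2 0 1 : H2)‖ * (1 - ‖z‖)⁻¹) := by
              gcongr
          _ = (2 * (1 / 2)) ^ j * (‖(lp.single 2 0 1 : H2)‖ * (1 - ‖z‖)⁻¹) := by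
              rw [mul_pow]; ring
          _ = _ := by norm_num
      obtain ⟨j, hj⟩ := pow_unbounded_of_one_lt (‖(lp.single 2 0 1 : H2)‖ * (1 - ‖z‖)⁻¹) hgt
      exact absurd (hbd j) (not_le.2 hj)
    set c : ℝ := (1 / 2 : ℝ) ^ ((m : ℝ)⁻¹) with hc
    have hc1 : c < 1 := Real.rpow_lt_one (by norm_num) (by norm_num) (by positivity)
    have hle : sSup {r : ℝ | ∃ z ∈ ball (0:ℂ) 1, r = ‖v z‖} ≤ c := by
      refine csSup_le ⟨_, 0, by simp, rfl⟩ ?_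
      rintro _ ⟨z, hz, rfl⟩
      have h1 := key z (mem_ball_zero_iff.1 hz)
      have h2 : c ^ m = 1 / 2 := Real.rpow_inv_natCast_pow (by norm_num) (by omega)
      rw [← h2] at h1
      exact le_of_pow_le_pow_left₀ (by omega) (by positivity) h1
    linarith
end

section
/- Let λ ∈ ℂ be a primitive k-th root of unity, let φ(z) = λz, let w ∈ H^∞, and set v(z) = w(z)·w(λz)⋯w(λ^{k−1}z). Suppose ‖v‖_∞ = 1, v is non-constant, and the radial boundary values of v satisfy |v| = 1 on a subset of the unit circle 𝕋 of positive measure. Then T_{w,φ}ⁿ → 0 weakly on the Hardy space H² (i.e. T_{w,φ}ⁿ f → 0 weakly for every f ∈ H²), but (T_{w,φ}ⁿ) does not converge strongly to 0: in particular ‖vⁿ‖₂ does not tend to 0. -/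
open Complex Metric Filter Topology MeasureTheory

open ComplexConjugate in
lemma aux_orth (n m : ℕ) :
    ∫ θ in Set.Ico (0:ℝ) (2 * Real.pi), (Complex.exp (θ * I)) ^ n * conj (Complex.exp (θ * I) ^ m)
      = if n = m then (2 * Real.pi : ℂ) else 0 := by
  have h1 : ∀ θ : ℝ, (Complex.exp (θ * I)) ^ n * conj (Complex.exp (θ * I) ^ m)
      = Complex.exp ((((n:ℂ) - m) * I) * θ) := by
    intro θ
    rw [map_pow, ← Complex.exp_conj, ← Complex.exp_nat_mul, ← Complex.exp_nat_mul,
      ← Complex.exp_add]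
    congr 1
    simp
    ring
  simp_rw [h1]
  rw [integral_Ico_eq_integral_Ioc,
    ← intervalIntegral.integral_of_le (by positivity)]
  split_ifs with h
  · subst h; simp
  · have hc : ((n:ℂ) - m) * I ≠ 0 := by
      refine mul_ne_zero (sub_ne_zero.2 ?_) I_ne_zero
      exact_mod_cast h
    rw [integral_exp_mul_complex hc]
    have : Complex.exp (((n:ℂ) - m) * I * ((2 * Real.pi : ℝ) : ℂ)) = 1 := by
      rw [Complex.exp_eq_one_iff]
      exact ⟨(n:ℤ) - m, by push_cast; ring⟩
    rw [this]; simp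

open ComplexConjugate in
lemma aux_parseval_s7 (a : ℕ → ℂ) (ha : Summable fun n => ‖a n‖) :
    HasSum (fun n => 2 * Real.pi * ‖a n‖ ^ 2)
      (∫ θ in Set.Ico (0:ℝ) (2 * Real.pi), ‖∑' n, a n * (Complex.exp (θ * I)) ^ n‖ ^ 2) := by
  have hn : ∀ (θ : ℝ) (n : ℕ), ‖a n * (Complex.exp (θ * I)) ^ n‖ = ‖a n‖ := by
    intro θ n; simp [Complex.norm_exp_ofReal_mul_I]
  have hs : ∀ θ : ℝ, Summable fun n => ‖a n * (Complex.exp (θ * I)) ^ n‖ := by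
    intro θ; simpa only [hn] using ha
  have hs' : ∀ θ : ℝ, Summable fun n => ‖conj (a n * (Complex.exp (θ * I)) ^ n)‖ := by
    intro θ; simpa only [RCLike.norm_conj] using hs θ
  let F : ℕ × ℕ → ℝ → ℂ := fun p θ =>
    (a p.1 * (Complex.exp (θ * I)) ^ p.1) * conj (a p.2 * (Complex.exp (θ * I)) ^ p.2)
  have hF : ∀ p θ, ‖F p θ‖ = ‖a p.1‖ * ‖a p.2‖ := by
    intro p θ
    simp only [F, norm_mul _ (conj _), RCLike.norm_conj, hn]
  have hcont : ∀ p, Continuous (F p) := by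
    intro p; simp only [F]; fun_prop
  have key := hasSum_integral_of_summable_integral_norm
    (μ := volume.restrict (Set.Ico (0:ℝ) (2 * Real.pi))) (F := F)
    (fun p => ((hcont p).integrableOn_Icc (a := 0) (b := 2 * Real.pi)).mono_set
      Set.Ico_subset_Icc_self) (by
      simp only [hF, integral_const]
      simpa using ((ha.mul_of_nonneg ha (fun _ => norm_nonneg _) (fun _ => norm_nonneg _)).mul_left
        (volume.real (Set.Ico (0:ℝ) (2 * Real.pi)))))
  have hI : ∀ p, ∫ θ in Set.Ico (0:ℝ) (2 * Real.pi), F p θ =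
      if p.1 = p.2 then ((2 * Real.pi * ‖a p.1‖ ^ 2 : ℝ) : ℂ) else 0 := by
    intro p
    have : ∀ θ, F p θ = (a p.1 * conj (a p.2)) *
      ((Complex.exp (θ * I)) ^ p.1 * conj (Complex.exp (θ * I) ^ p.2)) := by
      intro θ; simp only [F, map_mul]; ring
    simp_rw [this]
    rw [integral_const_mul, aux_orth]
    split_ifs with h
    · rw [← h, Complex.mul_conj']; push_cast; ring
    · simp
  have hT : ∀ θ : ℝ, ∑' p, F p θ = ((‖∑' n, a n * (Complex.exp (θ * I)) ^ n‖ ^ 2 : ℝ) : ℂ) := by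
    intro θ
    rw [← tsum_mul_tsum_of_summable_norm (hs θ) (hs' θ), ← Complex.conj_tsum, Complex.mul_conj']
    push_cast; rfl
  simp_rw [hI, hT] at key
  rw [integral_complex_ofReal] at key
  have := key.prod_fiberwise (g := fun n => ((2 * Real.pi * ‖a n‖ ^ 2 : ℝ) : ℂ)) (by
    intro b
    simpa only using hasSum_ite_eq' b (((2 * Real.pi * ‖a b‖ ^ 2 : ℝ) : ℂ)))
  exact_mod_cast this

lemma aux_eval_summable (f : H2) (z : ℂ) (hz : z ∈ ball (0:ℂ) 1) :
    Summable fun n => ‖f n * z ^ n‖ := by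
  have hz' : ‖z‖ < 1 := by simpa using hz
  refine Summable.of_nonneg_of_le (fun _ => norm_nonneg _) (fun n => ?_)
    ((summable_geometric_of_lt_one (norm_nonneg z) hz').mul_left ‖f‖)
  rw [norm_mul, norm_pow]
  gcongr
  exact lp.norm_apply_le_norm (by norm_num) f n

lemma aux_mem (r : ℝ) (h0 : 0 ≤ r) (h1 : r < 1) (θ : ℝ) :
    (r:ℂ) * Complex.exp (θ * I) ∈ ball (0:ℂ) 1 := by
  simpa [Complex.norm_exp_ofReal_mul_I, abs_of_nonneg h0] using h1

lemma aux_parseval_H2 (f : H2) (r : ℝ) (h0 : 0 ≤ r) (h1 : r < 1) :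
    HasSum (fun n => 2 * Real.pi * (‖f n‖ * r ^ n) ^ 2)
      (∫ θ in Set.Ico (0:ℝ) (2 * Real.pi), ‖H2.eval f ((r:ℂ) * Complex.exp (θ * I))‖ ^ 2) := by
  have hr : (r:ℂ) ∈ ball (0:ℂ) 1 := by simpa [abs_of_nonneg h0] using h1
  have := aux_parseval_s7 _ (aux_eval_summable f r hr)
  simpa [H2.eval, mul_pow, mul_assoc, abs_of_nonneg h0] using this

lemma aux_int_le (f : H2) (r : ℝ) (h0 : 0 ≤ r) (h1 : r < 1) :
    (∫ θ in Set.Ico (0:ℝ) (2 * Real.pi), ‖H2.eval f ((r:ℂ) * Complex.exp (θ * I))‖ ^ 2)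
      ≤ 2 * Real.pi * ‖f‖ ^ 2 := by
  refine hasSum_le_of_sum_le (aux_parseval_H2 f r h0 h1) (fun s => ?_)
  rw [← Finset.mul_sum]
  have := lp.sum_rpow_le_norm_rpow (p := 2) (by norm_num) f s
  norm_num at this
  gcongr
  refine le_trans (Finset.sum_le_sum fun i _ => ?_) this
  gcongr
  exact mul_le_of_le_one_right (norm_nonneg _) (pow_le_one₀ h0 h1.le)

lemma aux_eval_cont (f : H2) (r : ℝ) (h0 : 0 ≤ r) (h1 : r < 1) :
    Continuous fun θ : ℝ => H2.eval f ((r:ℂ) * Complex.exp (θ * I)) := by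
  have hr : (r:ℂ) ∈ ball (0:ℂ) 1 := by simpa [abs_of_nonneg h0] using h1
  unfold H2.eval
  refine continuous_tsum (fun n => by fun_prop) (aux_eval_summable f r hr) (fun n θ => ?_)
  simp [Complex.norm_exp_ofReal_mul_I]

lemma aux_contr (f g : H2) (h : ∀ z ∈ ball (0:ℂ) 1, ‖H2.eval g z‖ ≤ ‖H2.eval f z‖) :
    ‖g‖ ≤ ‖f‖ := by
  refine lp.norm_le_of_forall_sum_le (by norm_num) (norm_nonneg _) (fun s => ?_)
  norm_num
  have hb : ∀ᶠ r : ℝ in 𝓝[<] 1, ∑ i ∈ s, (‖g i‖ * r ^ i) ^ 2 ≤ ‖f‖ ^ 2 := by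
    filter_upwards [Ioo_mem_nhdsLT (zero_lt_one' ℝ)] with r hr
    have h1 := sum_le_hasSum s (fun i _ => by positivity) (aux_parseval_H2 g r hr.1.le hr.2)
    have h2 := aux_int_le f r hr.1.le hr.2
    have h3 : (∫ θ in Set.Ico (0:ℝ) (2 * Real.pi), ‖H2.eval g ((r:ℂ) * Complex.exp (θ * I))‖ ^ 2)
      ≤ (∫ θ in Set.Ico (0:ℝ) (2 * Real.pi), ‖H2.eval f ((r:ℂ) * Complex.exp (θ * I))‖ ^ 2) := by
      refine setIntegral_mono ?_ ?_ (fun θ => ?_)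
      · exact (((aux_eval_cont g r hr.1.le hr.2).norm.pow 2).integrableOn_Icc).mono_set
          Set.Ico_subset_Icc_self
      · exact (((aux_eval_cont f r hr.1.le hr.2).norm.pow 2).integrableOn_Icc).mono_set
          Set.Ico_subset_Icc_self
      · have := h _ (aux_mem r hr.1.le hr.2 θ)
        dsimp only
        gcongr
    rw [← Finset.mul_sum] at h1
    exact le_of_mul_le_mul_left (h1.trans (h3.trans h2)) (by positivity)
  have hc : Continuous fun r : ℝ => ∑ i ∈ s, (‖g i‖ * r ^ i) ^ 2 := by fun_prop
  have ht := (hc.tendsto 1).mono_left (nhdsWithin_le_nhds (s := Set.Iio 1))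
  simpa using le_of_tendsto ht hb

lemma aux_ker (z : ℂ) (hz : z ∈ ball (0:ℂ) 1) :
    ∃ K : H2, ∀ f : H2, inner ℂ K f = H2.eval f z := by
  have hz' : ‖z‖ < 1 := by simpa using hz
  have hm : Memℓp (fun n : ℕ => (starRingEnd ℂ) (z ^ n)) 2 := by
    refine memℓp_gen ?_
    have := summable_geometric_of_lt_one (sq_nonneg ‖z‖) (by nlinarith [norm_nonneg z])
    refine this.congr (fun n => ?_)
    simp [← pow_mul, mul_comm]
  refine ⟨⟨_, hm⟩, fun f => ?_⟩
  rw [lp.inner_eq_tsum]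
  unfold H2.eval
  refine tsum_congr fun n => ?_
  simp [RCLike.inner_apply]

lemma aux_eval_zero (h : H2) (hh : ∀ z ∈ ball (0:ℂ) 1, H2.eval h z = 0) : h = 0 := by
  have := aux_contr 0 h (fun z hz => by rw [hh z hz]; simp)
  simpa using this

lemma aux_eval_inj (f g : H2) (h : ∀ z ∈ ball (0:ℂ) 1, H2.eval f z = H2.eval g z) : f = g := by
  rw [← sub_eq_zero]
  refine aux_eval_zero _ (fun z hz => ?_)
  obtain ⟨K, hK⟩ := aux_ker z hz
  rw [← hK, inner_sub_right, hK, hK, h z hz, sub_self]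

/-- bounded + pointwise convergence to zero implies weak convergence -/
lemma aux_weak (x : ℕ → H2) (C : ℝ) (hC : ∀ n, ‖x n‖ ≤ C)
    (hp : ∀ z ∈ ball (0:ℂ) 1, Tendsto (fun n => H2.eval (x n) z) atTop (𝓝 0)) (g : H2) :
    Tendsto (fun n => (inner ℂ g (x n) : ℂ)) atTop (𝓝 0) := by
  let S : Submodule ℂ H2 :=
    { carrier := {g | Tendsto (fun n => (inner ℂ g (x n) : ℂ)) atTop (𝓝 0)}
      add_mem' := by
        intro a b ha hb
        simpa [inner_add_left] using Tendsto.add ha hb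
      zero_mem' := by simp
      smul_mem' := by
        intro c a ha
        simpa [inner_smul_left, mul_comm] using Tendsto.const_mul ((starRingEnd ℂ) c) ha }
  have hS : S.topologicalClosure = ⊤ := by
    rw [Submodule.topologicalClosure_eq_top_iff, Submodule.eq_bot_iff]
    intro h hh
    refine aux_eval_zero h (fun z hz => ?_)
    obtain ⟨K, hK⟩ := aux_ker z hz
    rw [← hK]
    refine (Submodule.mem_orthogonal _ _).1 hh K ?_
    change Tendsto _ _ _
    simpa only [hK] using hp z hz
  have hC0 : 0 ≤ C := (norm_nonneg _).trans (hC 0)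
  have hg : g ∈ closure (S : Set H2) := by
    rw [← Submodule.topologicalClosure_coe, hS]; trivial
  rw [Metric.tendsto_atTop]
  intro ε hε
  obtain ⟨g', hg', hd⟩ := Metric.mem_closure_iff.1 hg (ε / (2 * (C + 1))) (by positivity)
  have hg'' : Tendsto (fun n => (inner ℂ g' (x n) : ℂ)) atTop (𝓝 0) := hg'
  obtain ⟨N, hN⟩ := Metric.tendsto_atTop.1 hg'' (ε / 2) (by positivity)
  refine ⟨N, fun n hn => ?_⟩
  have h1 := hN n hn
  rw [dist_zero_right] at h1 ⊢
  have h2 : inner ℂ g (x n) = inner ℂ (g - g') (x n) + inner ℂ g' (x n) := by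
    rw [inner_sub_left]; ring
  have h3 : ‖(inner ℂ (g - g') (x n) : ℂ)‖ ≤ ε / (2 * (C + 1)) * C := by
    refine (norm_inner_le_norm _ _).trans ?_
    rw [dist_eq_norm] at hd
    exact mul_le_mul hd.le (hC n) (norm_nonneg _) (by positivity)
  have h4 : ε / (2 * (C + 1)) * C ≤ ε / 2 := by
    rw [div_mul_eq_mul_div, div_le_div_iff₀ (by positivity) (by positivity)]
    nlinarith
  rw [h2]
  exact (norm_add_le _ _).trans_lt (by linarith)

/-- Let `λ` be a primitive `k`-th root of unity, `φ(z) = λz`, `w ∈ H^∞`,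
`v(z) = w(z)·w(λz)⋯w(λ^{k−1}z)`.  Suppose `‖v‖_∞ = 1`, `v` is non-constant, and the
radial boundary values of `v` have modulus `1` on a subset of the circle of positive
measure.  Then `T_{w,φ}ⁿ → 0` weakly on `H²`, but `(T_{w,φ}ⁿ)` does not converge
strongly to `0`; in particular `‖vⁿ‖₂` does not tend to `0`. -/
theorem weak_but_not_strong_convergence_of_boundary_values_eq_one
    (k : ℕ) (hk : 0 < k) (lam : ℂ) (hlam : IsPrimitiveRoot lam k)
    (w : ℂ → ℂ) (hw : DifferentiableOn ℂ w (ball (0:ℂ) 1))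
    (hwb : ∃ M : ℝ, ∀ z ∈ ball (0:ℂ) 1, ‖w z‖ ≤ M)
    (v : ℂ → ℂ) (hv : ∀ z : ℂ, v z = ∏ j ∈ Finset.range k, w (lam ^ j * z))
    (hsup : sSup {r : ℝ | ∃ z ∈ ball (0:ℂ) 1, r = ‖v z‖} = 1)
    (hnonconst : ∃ z₁ ∈ ball (0:ℂ) 1, ∃ z₂ ∈ ball (0:ℂ) 1, v z₁ ≠ v z₂)
    (vstar : ℝ → ℂ)
    (hrad : ∀ᵐ θ : ℝ, Tendsto (fun r : ℝ => v ((r : ℂ) * Complex.exp (θ * Complex.I)))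
        (𝓝[<] (1:ℝ)) (𝓝 (vstar θ)))
    (hpos : 0 < volume {θ : ℝ | θ ∈ Set.Ico (0:ℝ) (2 * Real.pi) ∧ ‖vstar θ‖ = 1})
    (V : ℕ → H2) (hV : ∀ n : ℕ, ∀ z ∈ ball (0:ℂ) 1, H2.eval (V n) z = (v z) ^ n)
    (T : H2 →L[ℂ] H2)
    (hT : ∀ (f : H2), ∀ z ∈ ball (0:ℂ) 1, H2.eval (T f) z = w z * H2.eval f (lam * z)) :
    (∀ f g : H2, Tendsto (fun n : ℕ => (inner ℂ ((T ^ n) f) g : ℂ)) atTop (𝓝 0)) ∧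
    (¬ ∀ f : H2, Tendsto (fun n : ℕ => ‖(T ^ n) f‖) atTop (𝓝 0)) ∧
    ¬ Tendsto (fun n : ℕ => ‖V n‖) atTop (𝓝 0) := by
  have hl1 : ‖lam‖ = 1 := hlam.norm'_eq_one hk.ne'
  have hball : ∀ (j : ℕ), ∀ z ∈ ball (0:ℂ) 1, lam ^ j * z ∈ ball (0:ℂ) 1 := by
    intro j z hz; simpa [hl1] using hz
  obtain ⟨M, hM⟩ := hwb
  have hbdd : BddAbove {r : ℝ | ∃ z ∈ ball (0:ℂ) 1, r = ‖v z‖} := by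
    refine ⟨M ^ k, ?_⟩
    rintro r ⟨z, hz, rfl⟩
    rw [hv, norm_prod]
    calc _ ≤ ∏ j ∈ Finset.range k, M :=
          Finset.prod_le_prod (fun _ _ => norm_nonneg _) (fun j _ => hM _ (hball j z hz))
      _ = M ^ k := by simp
  have hv1 : ∀ z ∈ ball (0:ℂ) 1, ‖v z‖ ≤ 1 := fun z hz => hsup ▸ le_csSup hbdd ⟨z, hz, rfl⟩
  have hvd : DifferentiableOn ℂ v (ball (0:ℂ) 1) := by
    have : v = fun z => ∏ j ∈ Finset.range k, w (lam ^ j * z) := funext hv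
    rw [this]
    refine DifferentiableOn.fun_finsetProd (fun j _ => ?_)
    exact hw.comp (by fun_prop) (fun z hz => hball j z hz)
  have hvlt : ∀ z ∈ ball (0:ℂ) 1, ‖v z‖ < 1 := by
    intro z hz
    refine lt_of_le_of_ne (hv1 z hz) (fun h => ?_)
    have := Complex.eqOn_of_isPreconnected_of_isMaxOn_norm
      (convex_ball (0:ℂ) 1).isPreconnected isOpen_ball hvd hz
      (fun y hy => by simpa [h] using hv1 y hy)
    obtain ⟨z₁, h₁, z₂, h₂, hne⟩ := hnonconst
    exact hne ((this h₁).trans (this h₂).symm)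
  -- powers of T
  have hTn : ∀ (n : ℕ) (f : H2), ∀ z ∈ ball (0:ℂ) 1, H2.eval ((T ^ n) f) z =
      (∏ j ∈ Finset.range n, w (lam ^ j * z)) * H2.eval f (lam ^ n * z) := by
    intro n
    induction n with
    | zero => intro f z hz; simp
    | succ n ih =>
      intro f z hz
      rw [pow_succ, mul_apply_eq_comp, ih (T f) z hz, hT f _ (hball n z hz),
        Finset.prod_range_succ, ← mul_assoc lam, ← pow_succ', mul_assoc]
  have hMk : ∀ (f : H2), ∀ z ∈ ball (0:ℂ) 1, H2.eval ((T ^ k) f) z = v z * H2.eval f z := by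
    intro f z hz
    rw [hTn k f z hz, ← hv, hlam.pow_eq_one, one_mul]
  have hMq : ∀ (q : ℕ) (f : H2), ∀ z ∈ ball (0:ℂ) 1,
      H2.eval (((T ^ k) ^ q) f) z = v z ^ q * H2.eval f z := by
    intro q
    induction q with
    | zero => intro f z hz; simp
    | succ q ih =>
      intro f z hz
      rw [pow_succ, mul_apply_eq_comp, ih _ z hz, hMk f z hz, pow_succ, mul_assoc]
  have hMb : ∀ (q : ℕ) (f : H2), ‖((T ^ k) ^ q) f‖ ≤ ‖f‖ := by
    intro q f
    refine aux_contr _ _ (fun z hz => ?_)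
    rw [hMq q f z hz, norm_mul, norm_pow]
    exact mul_le_of_le_one_left (norm_nonneg _) (pow_le_one₀ (norm_nonneg _) (hv1 z hz))
  have hMw : ∀ f g : H2, Tendsto (fun q : ℕ => (inner ℂ g (((T ^ k) ^ q) f) : ℂ)) atTop (𝓝 0) := by
    intro f g
    refine aux_weak _ ‖f‖ (fun q => hMb q f) (fun z hz => ?_) g
    simp only [fun q => hMq q f z hz]
    simpa using (tendsto_pow_atTop_nhds_zero_of_norm_lt_one (hvlt z hz)).mul_const (H2.eval f z)
  have hVnot : ¬ Tendsto (fun n : ℕ => ‖V n‖) atTop (𝓝 0) := by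
    intro hVt
    set E := {θ : ℝ | θ ∈ Set.Ico (0:ℝ) (2 * Real.pi) ∧ ‖vstar θ‖ = 1} with hE
    set μ := volume.restrict (Set.Ico (0:ℝ) (2 * Real.pi)) with hμ
    have hEfin : volume E ≠ ⊤ :=
      ((measure_mono (fun θ h => h.1 : E ⊆ Set.Ico (0:ℝ) (2 * Real.pi))).trans_lt measure_Ico_lt_top).ne
    have hEpos : 0 < volume.real E := ENNReal.toReal_pos hpos.ne' hEfin
    have hradμ : ∀ᵐ (θ : ℝ) ∂μ, Tendsto (fun r : ℝ => v ((r : ℂ) * Complex.exp (θ * Complex.I)))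
        (𝓝[<] (1:ℝ)) (𝓝 (vstar θ)) := ae_restrict_of_ae hrad
    have hIoo : ∀ᶠ r : ℝ in 𝓝[<] 1, r ∈ Set.Ioo (0:ℝ) 1 := Ioo_mem_nhdsLT (zero_lt_one' ℝ)
    have hcont : ∀ r ∈ Set.Ioo (0:ℝ) 1,
        Continuous fun θ : ℝ => v ((r : ℂ) * Complex.exp (θ * Complex.I)) := by
      intro r hr
      exact hvd.continuousOn.comp_continuous (by fun_prop) (fun θ => aux_mem r hr.1.le hr.2 θ)
    have hb1 : ∀ᵐ (θ : ℝ) ∂μ, ‖vstar θ‖ ≤ 1 := by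
      filter_upwards [hradμ] with θ hθ
      refine le_of_tendsto hθ.norm ?_
      filter_upwards [hIoo] with r hr using hv1 _ (aux_mem r hr.1.le hr.2 θ)
    have hmeas : AEStronglyMeasurable vstar μ := by
      obtain ⟨u, -, hu, hut⟩ := exists_seq_strictMono_tendsto' (zero_lt_one' ℝ)
      have hut' : Tendsto u atTop (𝓝[<] 1) :=
        tendsto_nhdsWithin_iff.2 ⟨hut, Eventually.of_forall fun n => (hu n).2⟩
      refine aestronglyMeasurable_of_tendsto_ae atTop
        (f := fun n (θ : ℝ) => v (((u n : ℝ) : ℂ) * Complex.exp (θ * Complex.I)))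
        (fun n => (hcont _ (hu n)).aestronglyMeasurable) ?_
      filter_upwards [hradμ] with θ hθ using hθ.comp hut'
    have hlow : ∀ n : ℕ, volume.real E ≤ 2 * Real.pi * ‖V n‖ ^ 2 := by
      intro n
      have hlim : Tendsto (fun r : ℝ => ∫ θ : ℝ, ‖v ((r : ℂ) * Complex.exp (θ * Complex.I)) ^ n‖ ^ 2 ∂μ)
          (𝓝[<] 1) (𝓝 (∫ θ : ℝ, ‖vstar θ ^ n‖ ^ 2 ∂μ)) := by
        refine tendsto_integral_filter_of_dominated_convergence (fun _ => 1) ?_ ?_ ?_ ?_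
        · filter_upwards [hIoo] with r hr
          exact (((hcont r hr).pow n).norm.pow 2).aestronglyMeasurable
        · filter_upwards [hIoo] with r hr
          refine Eventually.of_forall fun θ => ?_
          have := hv1 _ (aux_mem r hr.1.le hr.2 θ)
          rw [norm_pow, norm_norm, norm_pow, ← pow_mul]
          exact pow_le_one₀ (norm_nonneg _) this
        · exact integrable_const _
        · filter_upwards [hradμ] with θ hθ using (hθ.pow n).norm.pow 2
      have hup : (∫ θ : ℝ, ‖vstar θ ^ n‖ ^ 2 ∂μ) ≤ 2 * Real.pi * ‖V n‖ ^ 2 := by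
        refine le_of_tendsto hlim ?_
        filter_upwards [hIoo] with r hr
        have := aux_int_le (V n) r hr.1.le hr.2
        simpa only [fun θ : ℝ => hV n _ (aux_mem r hr.1.le hr.2 θ)] using this
      have hint : Integrable (fun θ => ‖vstar θ ^ n‖ ^ 2) μ := by
        refine Integrable.mono' (integrable_const (1:ℝ)) ((hmeas.pow n).norm.pow 2) ?_
        filter_upwards [hb1] with θ hθ
        rw [norm_pow, norm_norm, norm_pow, ← pow_mul]
        exact pow_le_one₀ (norm_nonneg _) hθ
      have hm := mul_meas_ge_le_integral_of_nonneg
        (Eventually.of_forall fun θ => by positivity) hint 1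
      rw [one_mul] at hm
      refine le_trans ?_ (hm.trans hup)
      have hEμ : volume.real E = μ.real E := by
        rw [hμ, measureReal_def, measureReal_def, Measure.restrict_apply' measurableSet_Ico,
          Set.inter_eq_left.2 (fun θ h => h.1)]
      rw [hEμ]
      refine measureReal_mono (fun θ h => ?_) (measure_ne_top _ _)
      simp [h.2]
    have hlim0 : Tendsto (fun n => 2 * Real.pi * ‖V n‖ ^ 2) atTop (𝓝 0) := by
      simpa using (hVt.pow 2).const_mul (2 * Real.pi)
    exact absurd (ge_of_tendsto' hlim0 hlow) (not_le.2 hEpos)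
  refine ⟨?_, ?_, hVnot⟩
  · intro f g
    have hsum : Tendsto (fun n : ℕ => ∑ r ∈ Finset.range k,
        ‖(inner ℂ g (((T ^ k) ^ (n / k)) ((T ^ r) f)) : ℂ)‖) atTop (𝓝 0) := by
      have := tendsto_finsetSum (Finset.range k) (fun r _ =>
        ((hMw ((T ^ r) f) g).norm.comp (Nat.tendsto_div_const_atTop hk.ne')))
      simpa using this
    refine squeeze_zero_norm (fun n => ?_) hsum
    rw [norm_inner_symm]
    have h1 : (T ^ n) f = ((T ^ k) ^ (n / k)) ((T ^ (n % k)) f) := by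
      rw [← mul_apply_eq_comp, ← pow_mul, ← pow_add, Nat.div_add_mod]
    rw [h1]
    exact Finset.single_le_sum
      (f := fun r => ‖(inner ℂ g (((T ^ k) ^ (n / k)) ((T ^ r) f)) : ℂ)‖)
      (fun _ _ => norm_nonneg _) (Finset.mem_range.2 (Nat.mod_lt n hk))
  · intro h
    apply hVnot
    have h1 := (h (V 0)).comp (tendsto_id.const_mul_atTop' hk : Tendsto (fun q : ℕ => k * q) atTop atTop)
    refine h1.congr (fun q => ?_)
    have : (T ^ (k * q)) (V 0) = V q := by
      refine aux_eval_inj _ _ (fun z hz => ?_)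
      rw [pow_mul, hMq q _ z hz, hV 0 z hz, hV q z hz]; simp
    simp only [Function.comp_apply, this]
end
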